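/- Let G be a finite simple graph with at least one edge, with no K_6-minor, and such that every edge incident to a vertex of degree at most 7 belongs to at least 4 triangles. Then the minimum degree of G is at least 6, and for every vertex u of degree at most 7, the induced subgraph G[N(u)] has minimum degree at least 4. -/

import Mathlib

open SimpleGraph

/-- `H` is a minor of `G`: there is a family of nonempty, pairwise disjoint,
connected branch sets in `G`, one for each vertex of `H`, with an edge of `G`
between the branch sets corresponding to each edge of `H`. -/
def SimpleGraph.MinorOf {W V : Type} (H : SimpleGraph W) (G : SimpleGraph V) : Prop :=
  ∃ f : W → Set V,
    (∀ w, (f w).Nonempty) ∧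
    (∀ w, (G.induce (f w)).Connected) ∧
    (∀ w₁ w₂, w₁ ≠ w₂ → Disjoint (f w₁) (f w₂)) ∧
    (∀ w₁ w₂, H.Adj w₁ w₂ → ∃ v₁ ∈ f w₁, ∃ v₂ ∈ f w₂, G.Adj v₁ v₂)

/-- The natural number whose binary digits are the given list. -/
def encode : List Bool → ℕ
  | [] => 0
  | b :: l => 2 * encode l + cond b 1 0

/-- The position of the unordered pair `{i, j}` in the colexicographic order. -/
def pairIdx (i j : ℕ) : ℕ := if i < j then j * (j - 1) / 2 + i else i * (i - 1) / 2 + j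

/-- At most `c` entries of the list are `false`. -/
def atMostFalse : ℕ → List Bool → Bool
  | _, [] => true
  | c, true :: l => atMostFalse c l
  | 0, false :: _ => false
  | c + 1, false :: l => atMostFalse c l

/-- The set of all pairs between `X` and `Y`, as a bit mask. -/
def joinMask (X Y : List ℕ) : ℕ :=
  (X.product Y).foldr (fun p s => 2 ^ pairIdx p.1 p.2 ||| s) 0

/-- The bit masks of the single pairs inside `X`. -/
def cliqueMasks : List ℕ → List ℕ
  | [] => []
  | x :: X => X.map (fun y => joinMask [x] [y]) ++ cliqueMasks X

/-- A graph code meets all these masks iff the given parts are cliques, any two of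
which are joined by an edge. -/
def modelMasks : List (List ℕ) → List ℕ
  | [] => []
  | X :: P => cliqueMasks X ++ (P.map (joinMask X) ++ modelMasks P)

def meetsAll (m : ℕ) : List ℕ → Bool
  | [] => true
  | s :: l => cond (Nat.beq (Nat.land m s) 0) false (meetsAll m l)

def meetsSome (m : ℕ) : List (List ℕ) → Bool
  | [] => false
  | s :: l => cond (meetsAll m s) true (meetsSome m l)

/-- Either the graph on `k` vertices with code `m` has one of the models in `M`, or it gets one
as soon as any edge is added, it has no clique on four vertices, and it has at least four
vertices of degree at most four. -/
def goodCode (k : ℕ) (M : List (List ℕ)) (m : ℕ) : Bool :=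
  meetsSome m M ||
    (((List.range k).all fun j => (List.range j).all fun i =>
        m.testBit (pairIdx i j) || meetsSome (m ||| 2 ^ pairIdx i j) M) &&
     ((List.range k).all fun i => (List.range i).all fun j => !m.testBit (pairIdx i j) ||
        (List.range j).all fun l => !(m.testBit (pairIdx i l) && m.testBit (pairIdx j l)) ||
        (List.range l).all fun n => !(m.testBit (pairIdx i n) && m.testBit (pairIdx j n) &&
          m.testBit (pairIdx l n))) &&
     Nat.ble 4 ((List.range k).filter fun i =>
       Nat.ble ((List.range k).filter fun j => i != j && m.testBit (pairIdx i j)).length 4).length)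

/-- Partitions of six vertices into five parts. -/
def sixModels : List (List (List ℕ)) :=
  [[[0, 1], [2], [3], [4], [5]], [[2, 3], [0], [1], [4], [5]], [[0, 2], [1], [3], [4], [5]],
    [[1, 4], [0], [2], [3], [5]], [[3, 4], [0], [1], [2], [5]], [[0, 3], [1], [2], [4], [5]],
    [[1, 2], [0], [3], [4], [5]], [[0, 4], [1], [2], [3], [5]]]

/-- Partitions of seven vertices into five parts. -/
def sevenModels : List (List (List ℕ)) :=
  [[[1, 3], [2, 4], [0], [5], [6]], [[1, 4], [2, 5], [0], [3], [6]], [[1, 5], [2, 3], [0], [4], [6]],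
    [[1, 2], [3, 4], [0], [5], [6]], [[1, 2], [3, 5], [0], [4], [6]], [[1, 3], [2, 6], [0], [4], [5]],
    [[1, 6], [2, 3], [0], [4], [5]], [[1, 5], [2, 6], [0], [3], [4]], [[1, 6], [2, 4], [0], [3], [5]],
    [[1, 3], [5, 6], [0], [2], [4]], [[0, 1], [4, 5], [2], [3], [6]], [[0, 5], [1, 2], [3], [4], [6]],
    [[0, 1], [4, 6], [2], [3], [5]], [[0, 3], [1, 4], [2], [5], [6]], [[2, 5], [4, 6], [0], [1], [3]],
    [[3, 6], [4, 5], [0], [1], [2]], [[3, 4], [5, 6], [0], [1], [2]], [[3, 5], [4, 6], [0], [1], [2]],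
    [[1, 2], [4, 6], [0], [3], [5]], [[1, 4], [2, 6], [0], [3], [5]]]

theorem goodCode_six :
    ∀ a01 a02 a03 a04 a05 : Bool, atMostFalse 1 [a01, a02, a03, a04, a05] = true →
    ∀ a12 a13 a14 a15 : Bool, atMostFalse 1 [a01, a12, a13, a14, a15] = true →
    ∀ a23 a24 a25 : Bool, atMostFalse 1 [a02, a12, a23, a24, a25] = true →
    ∀ a34 a35 : Bool, atMostFalse 1 [a03, a13, a23, a34, a35] = true →
    ∀ a45 : Bool, atMostFalse 1 [a04, a14, a24, a34, a45] = true →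
    atMostFalse 1 [a05, a15, a25, a35, a45] = true →
    goodCode 6 (sixModels.map modelMasks) (encode [a01,
      a02, a12,
      a03, a13, a23,
      a04, a14, a24, a34,
      a05, a15, a25, a35, a45]) = true := by
  decide +kernel

set_option synthInstance.maxHeartbeats 1000000 in
set_option synthInstance.maxSize 1000 in
set_option maxHeartbeats 2000000 in
theorem goodCode_seven :
    ∀ a01 a02 a03 a04 a05 a06 : Bool, (a03 && a04 && a05 && a06) = true →
    ∀ a12 a13 a14 a15 a16 : Bool, atMostFalse 2 [a01, a12, a13, a14, a15, a16] = true →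
    ∀ a23 a24 a25 a26 : Bool, atMostFalse 2 [a02, a12, a23, a24, a25, a26] = true →
    ∀ a34 a35 a36 : Bool, atMostFalse 2 [a03, a13, a23, a34, a35, a36] = true →
    ∀ a45 a46 : Bool, atMostFalse 2 [a04, a14, a24, a34, a45, a46] = true →
    ∀ a56 : Bool, atMostFalse 2 [a05, a15, a25, a35, a45, a56] = true →
    atMostFalse 2 [a06, a16, a26, a36, a46, a56] = true →
    goodCode 7 (sevenModels.map modelMasks) (encode [a01,
      a02, a12,
      a03, a13, a23,
      a04, a14, a24, a34,
      a05, a15, a25, a35, a45,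
      a06, a16, a26, a36, a46, a56]) = true := by
  decide +kernel

section

open Finset

theorem exists_testBit_of_joinMask {m : ℕ} {X Y : List ℕ} (h : m &&& joinMask X Y ≠ 0) :
    ∃ x ∈ X, ∃ y ∈ Y, m.testBit (pairIdx x y) = true := by
  obtain ⟨p, hp, hb⟩ : ∃ p ∈ X.product Y, m.testBit (pairIdx p.1 p.2) = true := by
    unfold joinMask at h
    generalize X.product Y = L at h ⊢
    induction L with
    | nil => simp at h
    | cons p L ih =>
      by_cases hp : m.testBit (pairIdx p.1 p.2) = true
      · exact ⟨p, by simp, hp⟩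
      · have h0 : m &&& 2 ^ pairIdx p.1 p.2 = 0 := by
          rw [Nat.and_two_pow]
          simp [hp]
        rw [List.foldr_cons, Nat.and_or_distrib_left, h0, Nat.zero_or] at h
        obtain ⟨q, hq, hb⟩ := ih h
        exact ⟨q, List.mem_cons_of_mem _ hq, hb⟩
  rcases p with ⟨x, y⟩
  rw [List.pair_mem_product] at hp
  exact ⟨x, hp.1, y, hp.2, hb⟩

theorem and_ne_zero_of_meetsAll {m : ℕ} {l : List ℕ} (h : meetsAll m l = true) :
    ∀ s ∈ l, m &&& s ≠ 0 := by
  induction l with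
  | nil => simp
  | cons s l ih =>
    rw [meetsAll] at h
    by_cases hs : m &&& s = 0
    · have : Nat.beq (Nat.land m s) 0 = true := by
        rw [Nat.beq_eq]; exact hs
      rw [this, cond_true] at h
      exact absurd h Bool.false_ne_true
    · have : Nat.beq (Nat.land m s) 0 = false := by
        rw [← Bool.not_eq_true, Nat.beq_eq]; exact hs
      simp only [this, cond_false] at h
      simpa [hs] using ih h

theorem exists_meetsAll_of_meetsSome {m : ℕ} {M : List (List ℕ)} (h : meetsSome m M = true) :
    ∃ s ∈ M, meetsAll m s = true := by
  induction M with
  | nil => simp [meetsSome] at h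
  | cons s l ih =>
    rw [meetsSome] at h
    by_cases hs : meetsAll m s = true
    · exact ⟨s, by simp, hs⟩
    · simp only [hs, cond_false] at h
      obtain ⟨t, ht, hm⟩ := ih h
      exact ⟨t, List.mem_cons_of_mem _ ht, hm⟩

theorem pairwise_of_cliqueMasks {m : ℕ} {X : List ℕ} (h : ∀ s ∈ cliqueMasks X, m &&& s ≠ 0) :
    X.Pairwise fun x y => m.testBit (pairIdx x y) = true := by
  induction X with
  | nil => simp
  | cons x X ih =>
    simp only [cliqueMasks, List.mem_append, List.mem_map] at h
    refine List.pairwise_cons.2 ⟨fun y hy => ?_, ih fun s hs => h s (Or.inr hs)⟩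
    simpa using exists_testBit_of_joinMask (h _ (Or.inl ⟨y, hy, rfl⟩))

theorem pairwise_of_modelMasks {m : ℕ} {P : List (List ℕ)}
    (h : ∀ s ∈ modelMasks P, m &&& s ≠ 0) :
    (∀ X ∈ P, X.Pairwise fun x y => m.testBit (pairIdx x y) = true) ∧
      P.Pairwise fun X Y => ∃ x ∈ X, ∃ y ∈ Y, m.testBit (pairIdx x y) = true := by
  induction P with
  | nil => simp
  | cons X P ih =>
    simp only [modelMasks, List.mem_append, List.mem_map] at h
    obtain ⟨h1, h2⟩ := ih fun s hs => h s (Or.inr (Or.inr hs))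
    refine ⟨?_, List.pairwise_cons.2 ⟨fun Y hY => ?_, h2⟩⟩
    · intro Y hY
      rcases List.mem_cons.1 hY with rfl | hY
      · exact pairwise_of_cliqueMasks fun s hs => h s (Or.inl hs)
      · exact h1 Y hY
    · exact exists_testBit_of_joinMask (h _ (Or.inr (Or.inl ⟨Y, hY, rfl⟩)))

/-- A partition of some of the numbers below `k` into five nonempty parts. -/
def IsFivePartition (k : ℕ) (P : List (List ℕ)) : Prop :=
  P.length = 5 ∧ P.Pairwise List.Disjoint ∧ (∀ X ∈ P, X ≠ []) ∧ ∀ X ∈ P, ∀ x ∈ X, x < k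

theorem isFivePartition_sixModels : ∀ P ∈ sixModels, IsFivePartition 6 P := by
  unfold IsFivePartition List.Disjoint
  simp [sixModels]

theorem isFivePartition_sevenModels : ∀ P ∈ sevenModels, IsFivePartition 7 P := by
  unfold IsFivePartition List.Disjoint
  simp [sevenModels]

theorem pairIdx_inj {i j i' j' : ℕ} (hi : i < 7) (hj : j < i) (hi' : i' < 7) (hj' : j' < i')
    (h : pairIdx i j = pairIdx i' j') : i = i' ∧ j = j' := by
  have key : ∀ a ∈ List.range 7, ∀ b ∈ List.range a, ∀ c ∈ List.range 7, ∀ d ∈ List.range c,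
      pairIdx a b = pairIdx c d → a = c ∧ b = d := by
    decide +kernel
  simp only [List.mem_range] at key
  exact key i hi j hj i' hi' j' hj' h

theorem pairIdx_comm (i j : ℕ) : pairIdx i j = pairIdx j i := by
  unfold pairIdx
  rcases lt_trichotomy i j with h | rfl | h
  · simp [h, h.le.not_gt]
  · rfl
  · simp [h, h.le.not_gt]

theorem testBit_encode (L : List Bool) (k : ℕ) : (encode L).testBit k = L.getD k false := by
  induction L generalizing k with
  | nil => simp [encode]
  | cons b L ih =>
    have hb : (2 * encode L + cond b 1 0) = Nat.bit b (encode L) := by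
      cases b <;> simp [Nat.bit]
    rw [encode, hb]
    cases k with
    | zero => simp
    | succ k => rw [Nat.testBit_bit_succ, ih]; rfl

theorem atMostFalse_of_countP {c : ℕ} {l : List Bool} (h : l.countP (! ·) ≤ c) :
    atMostFalse c l = true := by
  induction l generalizing c with
  | nil => cases c <;> rfl
  | cons b l ih =>
    cases b
    · simp at h
      cases c with
      | zero => omega
      | succ c => exact ih (by omega)
    · have : atMostFalse c (true :: l) = atMostFalse c l := by cases c <;> rfl
      rw [this]
      exact ih (by simpa using h)

open scoped Classical

variable {V : Type}

/-- `X` is nonempty and any two of its vertices are joined by a walk inside `X`. -/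
def ConnectedOn (G : SimpleGraph V) (X : Set V) : Prop :=
  X.Nonempty ∧ ∀ p ∈ X, ∀ q ∈ X, Relation.ReflTransGen (fun x y => G.Adj x y ∧ y ∈ X) p q

/-- The complete graph on six vertices is a minor of the subgraph of `G` induced by `A`. -/
def HasK6 (G : SimpleGraph V) (A : Set V) : Prop :=
  ∃ f : Fin 6 → Set V, (∀ i, f i ⊆ A) ∧ (∀ i, ConnectedOn G (f i)) ∧
    (∀ i j, i ≠ j → Disjoint (f i) (f j)) ∧ ∀ i j, i ≠ j → ∃ x ∈ f i, ∃ y ∈ f j, G.Adj x y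

theorem ConnectedOn.induce_connected {G : SimpleGraph V} {X : Set V} (h : ConnectedOn G X) :
    (G.induce X).Connected := by
  obtain ⟨⟨x, hx⟩, h⟩ := h
  have key : ∀ (p : V) (hp : p ∈ X) (q : V),
      Relation.ReflTransGen (fun x y => G.Adj x y ∧ y ∈ X) p q →
      ∃ hq : q ∈ X, (G.induce X).Reachable ⟨p, hp⟩ ⟨q, hq⟩ := by
    intro p hp q hpq
    induction hpq with
    | refl => exact ⟨hp, Reachable.refl _⟩
    | tail _ hbc ih =>
      obtain ⟨hb, hr⟩ := ih
      refine ⟨hbc.2, hr.trans (Adj.reachable ?_)⟩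
      exact hbc.1
  have : Nonempty X := ⟨⟨x, hx⟩⟩
  exact ⟨fun p q => (key p p.2 q (h p p.2 q q.2)).2⟩

theorem HasK6.minorOf {G : SimpleGraph V} {A : Set V} (h : HasK6 G A) :
    (⊤ : SimpleGraph (Fin 6)).MinorOf G := by
  obtain ⟨f, -, hc, hd, ha⟩ := h
  exact ⟨f, fun w => (hc w).1, fun w => (hc w).induce_connected, hd, fun i j hij => ha i j hij⟩

theorem HasK6.mono {G H : SimpleGraph V} {A B : Set V} (h : HasK6 G A) (hG : G ≤ H)
    (hA : A ⊆ B) : HasK6 H B := by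
  obtain ⟨f, hf, hc, hd, ha⟩ := h
  refine ⟨f, fun i => (hf i).trans hA, fun i => ⟨(hc i).1, fun p hp q hq => ?_⟩, hd,
    fun i j hij => ?_⟩
  · exact Relation.ReflTransGen.mono (fun x y hxy => ⟨hG hxy.1, hxy.2⟩) _ _ ((hc i).2 p hp q hq)
  · obtain ⟨x, hx, y, hy, hxy⟩ := ha i j hij
    exact ⟨x, hx, y, hy, hG hxy⟩

theorem connectedOn_singleton (G : SimpleGraph V) (u : V) : ConnectedOn G {u} := by
  refine ⟨⟨u, rfl⟩, fun p hp q hq => ?_⟩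
  rw [Set.mem_singleton_iff] at hp hq
  subst hp hq
  exact .refl

/-- The graph obtained by adding the edges between `C` and the rest of the graph to the
vertex `a`. Outside of `C` it is the contraction of `C` into `a`. -/
def contractInto (G : SimpleGraph V) (C : Set V) (a : V) : SimpleGraph V where
  Adj v w := v ≠ w ∧ (G.Adj v w ∨ (v = a ∧ ∃ c ∈ C, G.Adj c w) ∨ (w = a ∧ ∃ c ∈ C, G.Adj c v))
  symm := ⟨by
    rintro v w ⟨hne, h | h | h⟩
    · exact ⟨hne.symm, Or.inl h.symm⟩
    · exact ⟨hne.symm, Or.inr (Or.inr h)⟩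
    · exact ⟨hne.symm, Or.inr (Or.inl h)⟩⟩
  loopless := ⟨fun v h => h.1 rfl⟩

theorem hasK6_of_contractInto {G : SimpleGraph V} {C A : Set V} {a : V} (hCA : C ⊆ A)
    (hC : ConnectedOn G C) (haC : ∃ c ∈ C, G.Adj c a)
    (h : HasK6 (contractInto G C a) (A \ C)) : HasK6 G A := by
  obtain ⟨f, hf, hc, hd, ha⟩ := h
  obtain ⟨c₀, hc₀, hac⟩ := haC
  have hfC : ∀ i, ∀ x ∈ f i, x ∉ C := fun i x hx => (hf i hx).2
  set g : Fin 6 → Set V := fun i => f i ∪ {x | x ∈ C ∧ a ∈ f i} with hg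
  have hfg : ∀ i, f i ⊆ g i := fun i => Set.subset_union_left
  have hCg : ∀ i, a ∈ f i → C ⊆ g i := fun i hi x hx => Or.inr ⟨hx, hi⟩
  have inC : ∀ i, a ∈ f i → ∀ p ∈ C, ∀ q ∈ C,
      Relation.ReflTransGen (fun x y => G.Adj x y ∧ y ∈ g i) p q := fun i hi p hp q hq =>
    Relation.ReflTransGen.mono (fun x y hxy => ⟨hxy.1, hCg i hi hxy.2⟩) _ _ (hC.2 p hp q hq)
  have step : ∀ i, ∀ p ∈ f i, ∀ q ∈ f i, (contractInto G C a).Adj p q →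
      Relation.ReflTransGen (fun x y => G.Adj x y ∧ y ∈ g i) p q := by
    rintro i p hp q hq ⟨-, h | ⟨rfl, c, hcC, hcq⟩ | ⟨rfl, c, hcC, hcp⟩⟩
    · exact .single ⟨h, hfg i hq⟩
    · exact ((Relation.ReflTransGen.single ⟨hac.symm, hCg i hp hc₀⟩).trans
        (inC i hp c₀ hc₀ c hcC)).tail ⟨hcq, hfg i hq⟩
    · exact ((Relation.ReflTransGen.single ⟨hcp.symm, hCg i hq hcC⟩).trans
        (inC i hq c hcC c₀ hc₀)).tail ⟨hac, hfg i hq⟩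
  have inf : ∀ i, ∀ p ∈ f i, ∀ q ∈ f i,
      Relation.ReflTransGen (fun x y => G.Adj x y ∧ y ∈ g i) p q := by
    intro i p hp q hq
    have key : q ∈ f i ∧ Relation.ReflTransGen (fun x y => G.Adj x y ∧ y ∈ g i) p q := by
      have := (hc i).2 p hp q hq
      clear hq
      induction this with
      | refl => exact ⟨hp, .refl⟩
      | tail _ hbc ih =>
        exact ⟨hbc.2, ih.2.trans (step i _ ih.1 _ hbc.2 hbc.1)⟩
    exact key.2
  refine ⟨g, ?_, ?_, ?_, ?_⟩
  · rintro i x (hx | hx)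
    · exact (hf i hx).1
    · exact hCA hx.1
  · intro i
    refine ⟨(hc i).1.mono (hfg i), ?_⟩
    rintro p (hp | ⟨hp, hi⟩) q (hq | ⟨hq, hi'⟩)
    · exact inf i p hp q hq
    · exact ((inf i p hp a hi').tail ⟨hac.symm, hCg i hi' hc₀⟩).trans (inC i hi' c₀ hc₀ q hq)
    · exact ((inC i hi p hp c₀ hc₀).tail ⟨hac, hfg i hi⟩).trans (inf i a hi q hq)
    · exact inC i hi p hp q hq
  · intro i j hij
    rw [Set.disjoint_left]
    rintro x (hx | ⟨hx, hi⟩) (hx' | ⟨hx', hj⟩)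
    · exact Set.disjoint_left.1 (hd i j hij) hx hx'
    · exact hfC i x hx hx'
    · exact hfC j x hx' hx
    · exact Set.disjoint_left.1 (hd i j hij) hi hj
  · intro i j hij
    obtain ⟨x, hx, y, hy, -, h | ⟨rfl, c, hcC, hcq⟩ | ⟨rfl, c, hcC, hcp⟩⟩ := ha i j hij
    · exact ⟨x, hfg i hx, y, hfg j hy, h⟩
    · exact ⟨c, hCg i hx hcC, y, hfg j hy, hcq⟩
    · exact ⟨x, hfg i hx, c, hCg j hy hcC, hcp.symm⟩

/-- A vertex `u` together with five connected sets, pairwise joined and all joined to `u`. -/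
theorem hasK6_of_meetsSome {G : SimpleGraph V} {A : Set V} {u : V} {k m : ℕ} {e : ℕ → V}
    {M : List (List (List ℕ))} (hM : ∀ P ∈ M, IsFivePartition k P)
    (hu : u ∈ A) (he : Set.InjOn e {i | i < k}) (heA : ∀ i < k, e i ∈ A)
    (hue : ∀ i < k, G.Adj u (e i))
    (hm : ∀ i < k, ∀ j < k, i ≠ j → m.testBit (pairIdx i j) = true → G.Adj (e i) (e j))
    (h : meetsSome m (M.map modelMasks) = true) : HasK6 G A := by
  obtain ⟨s, hs, hsm⟩ := exists_meetsAll_of_meetsSome h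
  obtain ⟨P, hP, rfl⟩ := List.mem_map.1 hs
  obtain ⟨hlen, hdisj, hne, hlt⟩ := hM P hP
  obtain ⟨hcl, hjoin⟩ := pairwise_of_modelMasks (and_ne_zero_of_meetsAll hsm)
  have hmem : ∀ i : Fin 5, P[i] ∈ P := fun i => List.getElem_mem _
  set f : Fin 5 → Set V := fun i => {v | ∃ x ∈ P[i], e x = v} with hf
  have hadj : ∀ i j : Fin 5, i < j → ∃ x ∈ f i, ∃ y ∈ f j, G.Adj x y := by
    intro i j hij
    obtain ⟨x, hx, y, hy, hb⟩ := List.pairwise_iff_getElem.1 hjoin i j (by omega) (by omega) hij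
    have hxy : x ≠ y := by
      rintro rfl
      exact List.pairwise_iff_getElem.1 hdisj i j (by omega) (by omega) hij hx hy
    exact ⟨e x, ⟨x, hx, rfl⟩, e y, ⟨y, hy, rfl⟩,
      hm x (hlt _ (hmem i) x hx) y (hlt _ (hmem j) y hy) hxy hb⟩
  have hdj : ∀ i j : Fin 5, i < j → Disjoint (f i) (f j) := by
    intro i j hij
    rw [Set.disjoint_left]
    rintro _ ⟨x, hx, rfl⟩ ⟨y, hy, hxy⟩
    have := he (hlt _ (hmem j) y hy) (hlt _ (hmem i) x hx) hxy
    subst this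
    exact List.pairwise_iff_getElem.1 hdisj i j (by omega) (by omega) hij hx hy
  have hu' : ∀ i, u ∉ f i := by
    rintro i ⟨x, hx, hxu⟩
    exact (hue x (hlt _ (hmem i) x hx)).ne hxu.symm
  have hne' : ∀ i, ∃ x ∈ f i, G.Adj u x := by
    intro i
    obtain ⟨x, hx⟩ := List.exists_mem_of_ne_nil _ (hne _ (hmem i))
    exact ⟨e x, ⟨x, hx, rfl⟩, hue x (hlt _ (hmem i) x hx)⟩
  have hconn : ∀ i, ConnectedOn G (f i) := by
    intro i
    refine ⟨(hne' i).imp fun x hx => hx.1, ?_⟩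
    rintro _ ⟨x, hx, rfl⟩ _ ⟨y, hy, rfl⟩
    by_cases hxy : x = y
    · subst hxy; exact .refl
    · refine .single ⟨hm x (hlt _ (hmem i) x hx) y (hlt _ (hmem i) y hy) hxy ?_, y, hy, rfl⟩
      have : Std.Symm fun x y => m.testBit (pairIdx x y) = true :=
        ⟨fun x y h => by rwa [pairIdx_comm]⟩
      exact (hcl _ (hmem i)).forall hx hy hxy
  refine ⟨Fin.cons {u} f, ?_, ?_, ?_, ?_⟩
  · intro i
    refine Fin.cases ?_ (fun i => ?_) i
    · simpa using hu
    · rintro _ ⟨x, hx, rfl⟩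
      exact heA x (hlt _ (hmem i) x hx)
  · intro i
    refine Fin.cases ?_ (fun i => ?_) i
    · exact connectedOn_singleton G u
    · exact hconn i
  · intro i j
    refine Fin.cases ?_ (fun i => ?_) i <;> refine Fin.cases ?_ (fun j => ?_) j
    · simp
    · intro _; simpa using hu' j
    · intro _; simpa using hu' i
    · intro hij
      rcases lt_or_gt_of_ne (fun h => hij (congrArg Fin.succ h)) with h | h
      · exact hdj i j h
      · exact (hdj j i h).symm
  · intro i j
    refine Fin.cases ?_ (fun i => ?_) i <;> refine Fin.cases ?_ (fun j => ?_) j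
    · simp
    · intro _
      obtain ⟨x, hx, h⟩ := hne' j
      exact ⟨u, rfl, x, hx, h⟩
    · intro _
      obtain ⟨x, hx, h⟩ := hne' i
      exact ⟨x, hx, u, rfl, h.symm⟩
    · intro hij
      rcases lt_or_gt_of_ne (fun h => hij (congrArg Fin.succ h)) with h | h
      · exact hadj i j h
      · obtain ⟨x, hx, y, hy, h⟩ := hadj j i h
        exact ⟨y, hy, x, hx, h.symm⟩

/-- The neighbors of `v` in `A`. -/
noncomputable def nbr (G : SimpleGraph V) (A : Finset V) (v : V) : Finset V := A.filter (G.Adj v)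

theorem mem_nbr {G : SimpleGraph V} {A : Finset V} {v w : V} :
    w ∈ nbr G A v ↔ w ∈ A ∧ G.Adj v w := Finset.mem_filter

/-- The properties of the neighborhood of `u` in `A` shared by the octahedron and the
pentagonal bipyramid. -/
structure TameAt (G : SimpleGraph V) (A : Finset V) (u : V) : Prop where
  six_le : 6 ≤ (nbr G A u).card
  adj_of_connectedOn : ∀ C : Set V, C ⊆ A → ConnectedOn G C → u ∉ C →
    (∀ x ∈ C, x ∉ nbr G A u) → ∀ a ∈ nbr G A u, ∀ b ∈ nbr G A u, a ≠ b →
    (∃ c ∈ C, G.Adj c a) → (∃ c ∈ C, G.Adj c b) → G.Adj a b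
  card_le_three : ∀ S ⊆ nbr G A u, G.IsClique (S : Set V) → S.card ≤ 3
  exists_card_le_four : ∀ S ⊆ nbr G A u, S.card ≤ 3 →
    ∃ w ∈ nbr G A u, w ∉ S ∧ (nbr G (nbr G A u) w).card ≤ 4

theorem tameAt_of_goodCode {G : SimpleGraph V} {A : Finset V} {u : V} {k m : ℕ} {e : ℕ → V}
    {M : List (List (List ℕ))} (hk6 : 6 ≤ k) (hk : k ≤ 7) (hM : ∀ P ∈ M, IsFivePartition k P)
    (hu : u ∈ A) (he : Set.InjOn e {i | i < k}) (hN : nbr G A u = (range k).image e)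
    (hm : ∀ i < k, ∀ j < k, i ≠ j → (m.testBit (pairIdx i j) = true ↔ G.Adj (e i) (e j)))
    (hgood : goodCode k (M.map modelMasks) m = true) (hno : ¬ HasK6 G (A : Set V)) :
    TameAt G A u := by
  have hmemN : ∀ i < k, e i ∈ nbr G A u := fun i hi => by
    rw [hN]; exact mem_image_of_mem _ (mem_range.2 hi)
  have hinv : ∀ v ∈ nbr G A u, ∃ i < k, e i = v := fun v hv => by
    rw [hN] at hv
    simpa using hv
  have hfalse : meetsSome m (M.map modelMasks) = false := by
    rw [← Bool.not_eq_true]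
    intro h
    exact hno (hasK6_of_meetsSome hM hu he (fun i hi => (mem_nbr.1 (hmemN i hi)).1)
      (fun i hi => (mem_nbr.1 (hmemN i hi)).2) (fun i hi j hj hij => (hm i hi j hj hij).1) h)
  simp only [goodCode, hfalse, Bool.false_or, Bool.and_eq_true, List.all_eq_true,
    List.mem_range, Bool.or_eq_true, Bool.not_eq_true', Nat.ble_eq] at hgood
  obtain ⟨⟨hadd, hfour⟩, hdeg⟩ := hgood
  refine ⟨?_, ?_, ?_, ?_⟩
  · rw [hN, card_image_of_injOn (by simpa [Set.InjOn] using he), card_range]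
    exact hk6
  · have key : ∀ j < k, ∀ i < j, ∀ C : Set V, C ⊆ A → ConnectedOn G C → u ∉ C →
        (∀ x ∈ C, x ∉ nbr G A u) → (∃ c ∈ C, G.Adj c (e i)) → (∃ c ∈ C, G.Adj c (e j)) →
        G.Adj (e i) (e j) := by
      intro j hj i hij C hCA hC huC hCN hCi hCj
      rcases hadd j hj i hij with h | h
      · exact (hm i (hij.trans hj) j hj hij.ne).1 h
      exfalso
      have hle : G ≤ contractInto G C (e i) := fun x y hxy => ⟨hxy.ne, Or.inl hxy⟩
      have hijne : e i ≠ e j := fun h => hij.ne (he (hij.trans hj) hj h)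
      have hnew : (contractInto G C (e i)).Adj (e i) (e j) :=
        ⟨hijne, Or.inr (Or.inl ⟨rfl, hCj⟩)⟩
      refine hno (hasK6_of_contractInto hCA hC hCi (hasK6_of_meetsSome (u := u) hM
        ⟨hu, huC⟩ he (fun x hx => ⟨(mem_nbr.1 (hmemN x hx)).1, fun hx' => hCN _ hx' (hmemN x hx)⟩)
        (fun x hx => hle (mem_nbr.1 (hmemN x hx)).2) ?_ h))
      intro x hx y hy hxy hb
      rw [Nat.testBit_or, Bool.or_eq_true, Nat.testBit_two_pow, decide_eq_true_eq] at hb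
      rcases hb with hb | hb
      · exact hle ((hm x hx y hy hxy).1 hb)
      · rw [pairIdx_comm i j] at hb
        rcases lt_or_gt_of_ne hxy with hlt | hlt
        · rw [pairIdx_comm x y] at hb
          obtain ⟨rfl, rfl⟩ := pairIdx_inj (by omega) hij (by omega) hlt hb
          exact hnew
        · obtain ⟨rfl, rfl⟩ := pairIdx_inj (by omega) hij (by omega) hlt hb
          exact hnew.symm
    intro C hCA hC huC hCN a ha b hb hab hCa hCb
    obtain ⟨i, hi, rfl⟩ := hinv a ha
    obtain ⟨j, hj, rfl⟩ := hinv b hb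
    rcases lt_trichotomy i j with h | rfl | h
    · exact key j hj i h C hCA hC huC hCN hCa hCb
    · exact absurd rfl hab
    · exact (key i hi j h C hCA hC huC hCN hCb hCa).symm
  · intro S hS hcl
    by_contra! h4
    set I := (range k).filter (fun i => e i ∈ S) with hI
    have hcard : 4 ≤ I.card := by
      have : S ⊆ I.image e := fun v hv => by
        obtain ⟨i, hi, rfl⟩ := hinv v (hS hv)
        exact mem_image_of_mem _ (mem_filter.2 ⟨mem_range.2 hi, hv⟩)
      exact le_trans h4 ((card_le_card this).trans card_image_le)
    obtain ⟨J, hJI, hJ⟩ := exists_subset_card_eq hcard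
    set o := J.orderEmbOfFin hJ
    have ho : ∀ t, o t < k ∧ e (o t) ∈ S := fun t => by
      have := mem_filter.1 (hJI (J.orderEmbOfFin_mem hJ t))
      exact ⟨mem_range.1 this.1, this.2⟩
    have hlt : ∀ s t : Fin 4, s < t → o s < o t := fun s t h => o.strictMono h
    have hbit : ∀ s t : Fin 4, s < t → m.testBit (pairIdx (o t) (o s)) = true := by
      intro s t h
      have hne := (hlt s t h).ne'
      refine (hm _ (ho t).1 _ (ho s).1 hne).2 (hcl (ho t).2 (ho s).2 fun h' => hne ?_)
      exact he (ho t).1 (ho s).1 h'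
    have := hfour (o 3) (ho 3).1 (o 2) (hlt 2 3 (by decide))
    rw [hbit 2 3 (by decide)] at this
    have := (this.resolve_left (by simp)) (o 1) (hlt 1 2 (by decide))
    rw [hbit 1 3 (by decide), hbit 1 2 (by decide)] at this
    have := (this.resolve_left (by simp)) (o 0) (hlt 0 1 (by decide))
    rw [hbit 0 3 (by decide), hbit 0 2 (by decide), hbit 0 1 (by decide)] at this
    simp at this
  · intro S hS hcard
    set I := (range k).filter (fun i => ((range k).filter fun j =>
      (i != j && m.testBit (pairIdx i j)) = true).card ≤ 4) with hI
    have hI4 : 4 ≤ I.card := by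
      refine hdeg.trans (le_of_eq ?_)
      rw [hI]
      change _ = (List.filter _ (List.range k)).length
      congr 2
      ext i
      rw [Bool.eq_iff_iff, Nat.ble_eq, decide_eq_true_eq]
      change _ ↔ (List.filter _ (List.range k)).length ≤ 4
      simp only [Bool.decide_eq_true]
    have hIe : (I.image e).card = I.card := card_image_of_injOn fun x hx y hy h =>
      he (mem_range.1 (mem_filter.1 hx).1) (mem_range.1 (mem_filter.1 hy).1) h
    obtain ⟨w, hw, hwS⟩ := exists_mem_notMem_of_card_lt_card (s := S) (t := I.image e) (by omega)
    obtain ⟨i, hi, rfl⟩ := mem_image.1 hw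
    obtain ⟨hik, hi4⟩ := mem_filter.1 hi
    rw [mem_range] at hik
    refine ⟨e i, hmemN i hik, hwS, le_trans ?_ hi4⟩
    refine le_trans (card_le_card ?_) (card_image_le (f := e))
    intro v hv
    obtain ⟨hv, hiv⟩ := mem_nbr.1 hv
    obtain ⟨j, hj, rfl⟩ := hinv v hv
    have hij : i ≠ j := fun h => hiv.ne (h ▸ rfl)
    refine mem_image_of_mem _ (mem_filter.2 ⟨mem_range.2 hj, ?_⟩)
    simp [hij, (hm i hik j hj hij).2 hiv]

theorem exists_enumeration {l : List V} (hl : l.Nodup) (d : V) :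
    Set.InjOn (fun i => l.getD i d) {i | i < l.length} ∧
      l.toFinset = (range l.length).image fun i => l.getD i d := by
  constructor
  · intro i hi j hj h
    simp only [Set.mem_ofPred_eq] at hi hj
    simp only [List.getD_eq_getElem _ _ hi, List.getD_eq_getElem _ _ hj] at h
    exact (List.Nodup.getElem_inj_iff hl).1 h
  · ext v
    simp only [List.mem_toFinset, mem_image, mem_range, List.mem_iff_getElem]
    constructor
    · rintro ⟨i, hi, rfl⟩
      exact ⟨i, hi, List.getD_eq_getElem _ _ hi⟩
    · rintro ⟨i, hi, rfl⟩
      exact ⟨i, hi, (List.getD_eq_getElem _ _ hi).symm⟩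

/-- The adjacency of the pair of `i` and `j` under the enumeration `e`. -/
noncomputable def adjBit (G : SimpleGraph V) (e : ℕ → V) (i j : ℕ) : Bool :=
  decide (G.Adj (e (min i j)) (e (max i j)))

theorem adjBit_iff {G : SimpleGraph V} {e : ℕ → V} {i j : ℕ} :
    adjBit G e i j = true ↔ G.Adj (e i) (e j) := by
  unfold adjBit
  rw [decide_eq_true_eq]
  rcases le_total i j with h | h
  · rw [min_eq_left h, max_eq_right h]
  · rw [min_eq_right h, max_eq_left h, G.adj_comm]

theorem atMostFalse_adjBit {G : SimpleGraph V} {N : Finset V} {k c i : ℕ} {e : ℕ → V}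
    (he : Set.InjOn e {i | i < k}) (hN : N = (range k).image e) (hk : k = c + 5) (hi : i < k)
    (h4 : 4 ≤ (nbr G N (e i)).card) :
    atMostFalse c (((List.range k).filter (· ≠ i)).map (adjBit G e i)) = true := by
  apply atMostFalse_of_countP
  have hNk : N.card = k := by
    rw [hN, card_image_of_injOn (by simpa [Set.InjOn] using he), card_range]
  set I := (range k).filter (fun j => j ≠ i ∧ ¬ G.Adj (e i) (e j)) with hI
  have h1 : (I.image e).card = I.card := card_image_of_injOn fun x hx y hy h =>
    he (mem_range.1 (mem_filter.1 hx).1) (mem_range.1 (mem_filter.1 hy).1) h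
  have hdis : Disjoint (insert (e i) (nbr G N (e i))) (I.image e) := by
    rw [Finset.disjoint_left]
    intro v hv hv'
    obtain ⟨j, hj, rfl⟩ := mem_image.1 hv'
    obtain ⟨hjk, hji, hadj⟩ := mem_filter.1 hj
    rcases mem_insert.1 hv with h | h
    · exact hji (he (mem_range.1 hjk) hi h)
    · exact hadj (mem_nbr.1 h).2
  have hsub : insert (e i) (nbr G N (e i)) ∪ I.image e ⊆ N := by
    refine union_subset (insert_subset ?_ (filter_subset _ _)) ?_
    · rw [hN]; exact mem_image_of_mem _ (mem_range.2 hi)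
    · rw [hN]; exact image_subset_image (filter_subset _ _)
  have hle := card_le_card hsub
  rw [card_union_of_disjoint hdis, card_insert_of_notMem (fun h => (mem_nbr.1 h).2.ne rfl)] at hle
  have hIc : I.card ≤ c := by omega
  refine le_trans (le_of_eq ?_) hIc
  rw [List.countP_map, List.countP_filter, List.countP_eq_length_filter]
  change _ = (List.filter _ (List.range k)).length
  congr 2
  ext j
  rw [Bool.eq_iff_iff]
  simp only [Function.comp_apply, Bool.and_eq_true, Bool.not_eq_true', decide_eq_true_eq,
    ← Bool.not_eq_true, adjBit_iff]
  exact and_comm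

theorem tameAt_of_card_eq_six {G : SimpleGraph V} {A : Finset V} {u : V} (hu : u ∈ A)
    (hcard : (nbr G A u).card = 6) (htri : ∀ v ∈ nbr G A u, 4 ≤ (nbr G (nbr G A u) v).card)
    (hno : ¬ HasK6 G (A : Set V)) : TameAt G A u := by
  have hlen : (nbr G A u).toList.length = 6 := by rw [length_toList, hcard]
  obtain ⟨he, hN⟩ := exists_enumeration (nbr G A u).nodup_toList u
  rw [toList_toFinset] at hN
  rw [hlen] at he hN
  set e : ℕ → V := fun i => (nbr G A u).toList.getD i u with hedef
  clear_value e
  have row : ∀ i < 6, atMostFalse 1 (((List.range 6).filter (· ≠ i)).map (adjBit G e i)) = true :=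
    fun i hi => atMostFalse_adjBit he hN rfl hi
      (htri _ (by rw [hN]; exact mem_image_of_mem _ (mem_range.2 hi)))
  refine tameAt_of_goodCode (le_refl 6) (by norm_num) isFivePartition_sixModels hu he hN ?_
    (goodCode_six (adjBit G e 0 1) (adjBit G e 0 2) (adjBit G e 0 3) (adjBit G e 0 4)
      (adjBit G e 0 5) (row 0 (by norm_num)) (adjBit G e 1 2) (adjBit G e 1 3) (adjBit G e 1 4)
      (adjBit G e 1 5) (row 1 (by norm_num)) (adjBit G e 2 3) (adjBit G e 2 4) (adjBit G e 2 5)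
      (row 2 (by norm_num)) (adjBit G e 3 4) (adjBit G e 3 5) (row 3 (by norm_num))
      (adjBit G e 4 5) (row 4 (by norm_num)) (row 5 (by norm_num))) hno
  intro i hi j hj hij
  rw [testBit_encode, ← adjBit_iff]
  interval_cases i <;> interval_cases j <;> first | exact absurd rfl hij | exact Iff.rfl

theorem tameAt_of_card_eq_seven {G : SimpleGraph V} {A : Finset V} {u : V} (hu : u ∈ A)
    (hcard : (nbr G A u).card = 7) (htri : ∀ v ∈ nbr G A u, 4 ≤ (nbr G (nbr G A u) v).card)
    (hno : ¬ HasK6 G (A : Set V)) : TameAt G A u := by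
  obtain ⟨v, hv⟩ : (nbr G A u).Nonempty := card_pos.1 (by omega)
  set N := nbr G A u with hNdef
  obtain ⟨F, hFsub, hF⟩ := exists_subset_card_eq (htri v hv)
  have hvF : v ∉ F := fun h => (mem_nbr.1 (hFsub h)).2.ne rfl
  have hFN : F ⊆ N := hFsub.trans (filter_subset _ _)
  set T := (N.erase v) \ F with hT
  have hTc : T.card = 2 := by
    rw [hT, card_sdiff_of_subset (subset_erase.2 ⟨hFN, hvF⟩),
      card_erase_of_mem hv]
    omega
  set l := v :: (T.toList ++ F.toList) with hl
  have hlen : l.length = 7 := by simp [hl, hTc, hF]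
  have hnd : l.Nodup := by
    rw [hl, List.nodup_cons]
    refine ⟨by simp [hT, hvF], List.Nodup.append T.nodup_toList F.nodup_toList ?_⟩
    intro x hx hx'
    rw [mem_toList] at hx hx'
    exact (mem_sdiff.1 hx).2 hx'
  have hlN : l.toFinset = N := by
    ext x
    simp only [hl, List.toFinset_cons, List.toFinset_append, toList_toFinset, mem_insert,
      mem_union, hT, mem_sdiff, mem_erase]
    constructor
    · rintro (rfl | h | h)
      · exact hv
      · exact h.1.2
      · exact hFN h
    · intro h
      by_cases hxv : x = v <;> by_cases hxF : x ∈ F <;> simp [hxv, hxF, h]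
  obtain ⟨he, hN⟩ := exists_enumeration hnd u
  rw [hlN] at hN
  rw [hlen] at he hN
  set e : ℕ → V := fun i => l.getD i u with hedef
  have he0 : e 0 = v := rfl
  have heF : ∀ i, 3 ≤ i → i < 7 → adjBit G e 0 i = true := by
    intro i h3 h7
    rw [adjBit_iff, he0]
    refine (mem_nbr.1 (hFsub ?_)).2
    have hTl : T.toList.length = 2 := by simp [hTc]
    have hFl : F.toList.length = 4 := by simp [hF]
    obtain ⟨j, rfl⟩ : ∃ j, i = j + 3 := ⟨i - 3, by omega⟩
    rw [← mem_toList, hedef]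
    simp only [hl, List.getD_cons_succ]
    rw [List.getD_append_right _ _ _ _ (by omega), List.getD_eq_getElem _ _ (by omega)]
    exact List.getElem_mem _
  clear_value e
  have row : ∀ i < 7, atMostFalse 2 (((List.range 7).filter (· ≠ i)).map (adjBit G e i)) = true :=
    fun i hi => atMostFalse_adjBit he hN rfl hi
      (htri _ (by rw [hN]; exact mem_image_of_mem _ (mem_range.2 hi)))
  refine tameAt_of_goodCode (by norm_num) (le_refl 7) isFivePartition_sevenModels hu he hN ?_
    (goodCode_seven (adjBit G e 0 1) (adjBit G e 0 2) (adjBit G e 0 3) (adjBit G e 0 4)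
      (adjBit G e 0 5) (adjBit G e 0 6) (by simp [heF]) (adjBit G e 1 2) (adjBit G e 1 3)
      (adjBit G e 1 4) (adjBit G e 1 5) (adjBit G e 1 6) (row 1 (by norm_num)) (adjBit G e 2 3)
      (adjBit G e 2 4) (adjBit G e 2 5) (adjBit G e 2 6) (row 2 (by norm_num)) (adjBit G e 3 4)
      (adjBit G e 3 5) (adjBit G e 3 6) (row 3 (by norm_num)) (adjBit G e 4 5)
      (adjBit G e 4 6) (row 4 (by norm_num)) (adjBit G e 5 6) (row 5 (by norm_num))
      (row 6 (by norm_num))) hno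
  intro i hi j hj hij
  rw [testBit_encode, ← adjBit_iff]
  interval_cases i <;> interval_cases j <;> first | exact absurd rfl hij | exact Iff.rfl

theorem tameAt_of_card_le_seven {G : SimpleGraph V} {A : Finset V} {u : V} (hu : u ∈ A)
    (hne : (nbr G A u).Nonempty) (hcard : (nbr G A u).card ≤ 7)
    (htri : ∀ v ∈ nbr G A u, 4 ≤ (nbr G (nbr G A u) v).card)
    (hno : ¬ HasK6 G (A : Set V)) : TameAt G A u := by
  obtain ⟨v, hv⟩ := hne
  have hlt : ∀ v ∈ nbr G A u, insert v (nbr G (nbr G A u) v) ⊆ nbr G A u := fun v hv =>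
    insert_subset hv (filter_subset _ _)
  have hins : ∀ v, (insert v (nbr G (nbr G A u) v)).card = (nbr G (nbr G A u) v).card + 1 :=
    fun v => card_insert_of_notMem fun h => (mem_nbr.1 h).2.ne rfl
  have h5 : 5 ≤ (nbr G A u).card := by
    have := card_le_card (hlt v hv)
    rw [hins] at this
    have := htri v hv
    omega
  rcases h5.eq_or_lt with h5 | h5
  · exfalso
    have hlen : (nbr G A u).toList.length = 5 := by rw [length_toList, h5]
    obtain ⟨he, hN⟩ := exists_enumeration (nbr G A u).nodup_toList u
    rw [toList_toFinset] at hN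
    rw [hlen] at he hN
    set e : ℕ → V := fun i => (nbr G A u).toList.getD i u with hedef
    clear_value e
    have hmem : ∀ i < 5, e i ∈ nbr G A u := fun i hi => by
      rw [hN]; exact mem_image_of_mem _ (mem_range.2 hi)
    refine hno (hasK6_of_meetsSome (u := u) (k := 5) (m := 2 ^ 10 - 1) (e := e)
      (M := [[[0], [1], [2], [3], [4]]]) ?_ hu he (fun i hi => (mem_nbr.1 (hmem i hi)).1)
      (fun i hi => (mem_nbr.1 (hmem i hi)).2) ?_ (by decide))
    · unfold IsFivePartition List.Disjoint
      simp
    · intro i hi j hj hij _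
      have : insert (e i) (nbr G (nbr G A u) (e i)) = nbr G A u :=
        eq_of_subset_of_card_le (hlt _ (hmem i hi))
          (by rw [hins]; have := htri _ (hmem i hi); omega)
      have hj' := hmem j hj
      rw [← this, mem_insert] at hj'
      rcases hj' with h | h
      · exact absurd (he hj hi h).symm hij
      · exact (mem_nbr.1 h).2
  · rcases (show 6 ≤ (nbr G A u).card from h5).eq_or_lt with h6 | h6
    · exact tameAt_of_card_eq_six hu h6.symm htri hno
    · exact tameAt_of_card_eq_seven hu (by omega) htri hno

theorem exists_component (G : SimpleGraph V) {R : Finset V} {x : V} (hx : x ∈ R) :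
    ∃ C ⊆ R, x ∈ C ∧ ConnectedOn G (C : Set V) ∧ ∀ y ∈ C, ∀ z ∈ R, G.Adj y z → z ∈ C := by
  set r : V → V → Prop := fun y z => G.Adj y z ∧ z ∈ R with hr
  set C := R.filter (Relation.ReflTransGen r x) with hC
  have hxC : x ∈ C := mem_filter.2 ⟨hx, .refl⟩
  have hclosed : ∀ y ∈ C, ∀ z ∈ R, G.Adj y z → z ∈ C := fun y hy z hz hyz =>
    mem_filter.2 ⟨hz, (mem_filter.1 hy).2.tail ⟨hyz, hz⟩⟩
  have hfrom : ∀ q, Relation.ReflTransGen r x q →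
      Relation.ReflTransGen (fun y z => G.Adj y z ∧ z ∈ (C : Set V)) x q ∧
      Relation.ReflTransGen (fun y z => G.Adj y z ∧ z ∈ (C : Set V)) q x ∧ q ∈ C := by
    intro q hq
    induction hq with
    | refl => exact ⟨.refl, .refl, hxC⟩
    | tail _ hbc ih =>
      have hcC := hclosed _ ih.2.2 _ hbc.2 hbc.1
      exact ⟨ih.1.tail ⟨hbc.1, hcC⟩, .head ⟨hbc.1.symm, ih.2.2⟩ ih.2.1, hcC⟩
  refine ⟨C, filter_subset _ _, hxC, ⟨⟨x, hxC⟩, fun p hp q hq => ?_⟩, hclosed⟩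
  exact (hfrom p (mem_filter.1 hp).2).2.1.trans (hfrom q (mem_filter.1 hq).2).1

theorem ConnectedOn.subset_of_closed {G : SimpleGraph V} {C B : Set V} (hC : ConnectedOn G C)
    {y : V} (hyC : y ∈ C) (hyB : y ∈ B) (hB : ∀ p ∈ B, ∀ q ∈ C, G.Adj p q → q ∈ B) : C ⊆ B := by
  intro z hz
  have := hC.2 y hyC z hz
  clear hz
  induction this with
  | refl => exact hyB
  | tail _ hbc ih => exact hB _ ih _ hbc.2 hbc.1

/-- The ordered pairs of adjacent vertices in `A`. -/
noncomputable def adjPairs (G : SimpleGraph V) (A : Finset V) : Finset (V × V) :=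
  (A ×ˢ A).filter fun p => G.Adj p.1 p.2

theorem mem_adjPairs {G : SimpleGraph V} {A : Finset V} {p : V × V} :
    p ∈ adjPairs G A ↔ (p.1 ∈ A ∧ p.2 ∈ A) ∧ G.Adj p.1 p.2 := by
  rw [adjPairs, mem_filter, mem_product]

theorem card_adjPairs (G : SimpleGraph V) (A : Finset V) :
    (adjPairs G A).card = ∑ v ∈ A, (nbr G A v).card := by
  rw [adjPairs, card_filter, sum_product]
  exact sum_congr rfl fun v _ => (card_filter _ _).symm

theorem card_adjPairs_le_contractInto {G : SimpleGraph V} {A : Finset V} {x y : V} (hx : x ∈ A)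
    (hy : y ∈ A) (hxy : G.Adj x y) :
    (adjPairs G A).card ≤ (adjPairs (contractInto G {y} x) (A.erase y)).card +
      2 * (nbr G (nbr G A x) y).card + 2 := by
  set Z := ((nbr G A y).erase x) \ nbr G A x with hZ
  have hxN : x ∈ nbr G A y := mem_nbr.2 ⟨hx, hxy.symm⟩
  have hdeg : (nbr G A y).card = (nbr G (nbr G A x) y).card + Z.card + 1 := by
    have h1 := card_erase_add_one hxN
    have h2 := card_sdiff_add_card_inter ((nbr G A y).erase x) (nbr G A x)
    have h3 : ((nbr G A y).erase x) ∩ nbr G A x = nbr G (nbr G A x) y := by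
      ext v
      simp only [mem_inter, mem_erase, mem_nbr]
      constructor
      · rintro ⟨⟨-, -, h⟩, h'⟩; exact ⟨h', h⟩
      · rintro ⟨h', h⟩; exact ⟨⟨h'.2.ne', h'.1, h⟩, h'⟩
    rw [h3, ← hZ] at h2
    omega
  have h1 : adjPairs G A ⊆ adjPairs G (A.erase y) ∪ ({y} ×ˢ nbr G A y ∪ nbr G A y ×ˢ {y}) := by
    rintro ⟨a, b⟩ hp
    obtain ⟨⟨ha, hb⟩, hab⟩ := mem_adjPairs.1 hp
    simp only [mem_union, mem_adjPairs, mem_product, mem_singleton, mem_nbr, mem_erase] at *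
    by_cases hay : a = y
    · subst hay; exact Or.inr (Or.inl ⟨rfl, hb, hab⟩)
    by_cases hby : b = y
    · subst hby; exact Or.inr (Or.inr ⟨⟨ha, hab.symm⟩, rfl⟩)
    exact Or.inl ⟨⟨⟨hay, ha⟩, hby, hb⟩, hab⟩
  have h1' := (card_le_card h1).trans ((card_union_le _ _).trans
    (Nat.add_le_add_left (card_union_le _ _) _))
  have hZmem : ∀ z ∈ Z, z ≠ x ∧ z ∈ A ∧ G.Adj y z ∧ ¬ G.Adj x z := by
    intro z hz
    simp only [hZ, mem_sdiff, mem_erase, mem_nbr, not_and] at hz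
    exact ⟨hz.1.1, hz.1.2.1, hz.1.2.2, hz.2 hz.1.2.1⟩
  have h2 : adjPairs G (A.erase y) ∪ ({x} ×ˢ Z ∪ Z ×ˢ {x}) ⊆
      adjPairs (contractInto G {y} x) (A.erase y) := by
    refine union_subset ?_ (union_subset ?_ ?_)
    · intro p hp
      obtain ⟨hp, h⟩ := mem_adjPairs.1 hp
      exact mem_adjPairs.2 ⟨hp, h.ne, Or.inl h⟩
    · rintro ⟨a, b⟩ hp
      obtain ⟨ha, hb⟩ := mem_product.1 hp
      obtain rfl := mem_singleton.1 ha
      obtain ⟨hba, hbA, hyb, -⟩ := hZmem b hb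
      exact mem_adjPairs.2 ⟨⟨mem_erase.2 ⟨hxy.ne, hx⟩, mem_erase.2 ⟨hyb.ne', hbA⟩⟩,
        hba.symm, Or.inr (Or.inl ⟨rfl, y, rfl, hyb⟩)⟩
    · rintro ⟨b, a⟩ hp
      obtain ⟨hb, ha⟩ := mem_product.1 hp
      obtain rfl := mem_singleton.1 ha
      obtain ⟨hba, hbA, hyb, -⟩ := hZmem b hb
      exact mem_adjPairs.2 ⟨⟨mem_erase.2 ⟨hyb.ne', hbA⟩, mem_erase.2 ⟨hxy.ne, hx⟩⟩,
        hba, Or.inr (Or.inr ⟨rfl, y, rfl, hyb⟩)⟩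
  have hd1 : Disjoint ({x} ×ˢ Z) (Z ×ˢ ({x} : Finset V)) := by
    rw [Finset.disjoint_left]
    rintro ⟨a, b⟩ hp hp'
    have := mem_singleton.1 (mem_product.1 hp).1
    exact (hZmem a (mem_product.1 hp').1).1 this
  have hd2 : Disjoint (adjPairs G (A.erase y)) ({x} ×ˢ Z ∪ Z ×ˢ ({x} : Finset V)) := by
    rw [Finset.disjoint_left]
    rintro ⟨a, b⟩ hp hp'
    have hab : G.Adj a b := (mem_adjPairs.1 hp).2
    rcases mem_union.1 hp' with h | h
    · have ha : a = x := mem_singleton.1 (mem_product.1 h).1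
      subst ha
      exact (hZmem b (mem_product.1 h).2).2.2.2 hab
    · have hb : b = x := mem_singleton.1 (mem_product.1 h).2
      subst hb
      exact (hZmem a (mem_product.1 h).1).2.2.2 hab.symm
  have h2' := card_le_card h2
  rw [card_union_of_disjoint hd2, card_union_of_disjoint hd1] at h2'
  simp only [card_product, card_singleton, one_mul, mul_one] at h1' h2'
  omega

/-- The pieces of a separation of `A` along a clique in the neighborhood of `u`. -/
theorem TameAt.exists_separation {G : SimpleGraph V} {A : Finset V} {u x : V}
    (h : TameAt G A u) (hx : x ∈ A) (hxu : x ≠ u) (hxN : x ∉ nbr G A u) :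
    ∃ C S : Finset V, x ∈ C ∧ C ⊆ A ∧ u ∉ C ∧ Disjoint C (nbr G A u) ∧
      ConnectedOn G (C : Set V) ∧ S ⊆ nbr G A u ∧ G.IsClique (S : Set V) ∧ S.card ≤ 3 ∧
      ∀ c ∈ C, nbr G A c ⊆ C ∪ S := by
  obtain ⟨C, hCR, hxC, hC, hclosed⟩ := exists_component G (R := A \ insert u (nbr G A u))
    (x := x) (by simp [hx, hxu, hxN])
  have hCR' : ∀ c ∈ C, c ∈ A ∧ c ≠ u ∧ c ∉ nbr G A u := by
    intro c hc
    have := hCR hc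
    simpa only [mem_sdiff, mem_insert, not_or] using this
  set S := (nbr G A u).filter (fun a => ∃ c ∈ (C : Set V), G.Adj c a) with hS
  have hcl : G.IsClique (S : Set V) := by
    intro a ha b hb hab
    obtain ⟨ha, ha'⟩ := mem_filter.1 ha
    obtain ⟨hb, hb'⟩ := mem_filter.1 hb
    exact h.adj_of_connectedOn C (fun c hc => (hCR' c hc).1) hC (fun hu => (hCR' u hu).2.1 rfl)
      (fun c hc => (hCR' c hc).2.2) a ha b hb hab ha' hb'
  refine ⟨C, S, hxC, fun c hc => (hCR' c hc).1, fun hu => (hCR' u hu).2.1 rfl,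
    Finset.disjoint_left.2 fun c hc => (hCR' c hc).2.2, hC, filter_subset _ _, hcl,
    h.card_le_three S (filter_subset _ _) hcl, ?_⟩
  intro c hc y hy
  obtain ⟨hyA, hcy⟩ := mem_nbr.1 hy
  rw [mem_union]
  by_cases hyN : y ∈ nbr G A u
  · exact Or.inr (mem_filter.2 ⟨hyN, c, hc, hcy⟩)
  · refine Or.inl (hclosed c hc y ?_ hcy)
    have hyu : y ≠ u := by
      rintro rfl
      exact (hCR' c hc).2.2 (mem_nbr.2 ⟨(hCR' c hc).1, hcy.symm⟩)
    simp [hyA, hyu, hyN]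

theorem TameAt.exists_card_nbr_le_five {G : SimpleGraph V} {A T : Finset V} {u : V}
    (h : TameAt G A u) (hu : u ∈ A) (hT : T ⊆ nbr G A u) (hT3 : T.card ≤ 3)
    (hout : ∀ w ∈ nbr G A u, w ∉ T → nbr G A w ⊆ insert u (nbr G A u)) :
    ∃ w ∈ A, w ∉ T ∧ w ∈ nbr G A u ∧ (nbr G A w).Nonempty ∧ (nbr G A w).card ≤ 5 := by
  obtain ⟨w, hw, hwT, hw4⟩ := h.exists_card_le_four T hT hT3
  obtain ⟨hwA, huw⟩ := mem_nbr.1 hw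
  refine ⟨w, hwA, hwT, hw, ⟨u, mem_nbr.2 ⟨hu, huw.symm⟩⟩, ?_⟩
  have : nbr G A w ⊆ insert u (nbr G (nbr G A u) w) := by
    intro y hy
    rcases mem_insert.1 (hout w hw hwT hy) with rfl | hyN
    · exact mem_insert_self _ _
    · exact mem_insert_of_mem (mem_nbr.2 ⟨hyN, (mem_nbr.1 hy).2⟩)
  exact (card_le_card this).trans ((card_insert_le _ _).trans (by omega))

theorem hasK6_of_almost_extremal {G : SimpleGraph V} {A : Finset V}
    (ih : ∀ (H : SimpleGraph V) (B : Finset V), B.card < A.card → 4 ≤ B.card →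
      ¬ HasK6 H (B : Set V) → (adjPairs H B).card + 19 ≤ 8 * B.card)
    (h5 : 5 ≤ A.card) (hlo : 8 * A.card ≤ (adjPairs G A).card + 18)
    (hhi : (adjPairs G A).card < 8 * A.card) : HasK6 G (A : Set V) := by
  by_contra hno
  have htri : ∀ x ∈ A, ∀ y ∈ nbr G A x, 4 ≤ (nbr G (nbr G A x) y).card := by
    intro x hx y hy
    obtain ⟨hyA, hxy⟩ := mem_nbr.1 hy
    have h1 := card_adjPairs_le_contractInto hx hyA hxy
    have hc := card_erase_add_one hyA
    have h2 := ih (contractInto G {y} x) (A.erase y) (by omega) (by omega) (fun h => hno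
      (hasK6_of_contractInto (C := {y}) (a := x) (by simpa using hyA) (connectedOn_singleton G y)
        ⟨y, rfl, hxy.symm⟩ (by rwa [coe_erase] at h)))
    omega
  have hne : ∀ v ∈ A, (nbr G A v).Nonempty := by
    intro v hv
    rw [nonempty_iff_ne_empty]
    intro h
    have h1 : adjPairs G A ⊆ adjPairs G (A.erase v) := by
      intro p hp
      obtain ⟨⟨h1, h2⟩, h3⟩ := mem_adjPairs.1 hp
      have hnot : ∀ w ∈ A, ¬ G.Adj v w := fun w hw hvw => by
        have := mem_nbr.2 ⟨hw, hvw⟩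
        rw [h] at this
        exact absurd this (notMem_empty _)
      refine mem_adjPairs.2 ⟨⟨mem_erase.2 ⟨?_, h1⟩, mem_erase.2 ⟨?_, h2⟩⟩, h3⟩
      · rintro rfl; exact hnot _ h2 h3
      · rintro rfl; exact hnot _ h1 h3.symm
    have h1' := card_le_card h1
    have hc := card_erase_add_one hv
    have h2 := ih G (A.erase v) (by omega) (by omega)
      (fun h => hno (h.mono le_rfl (by simp)))
    omega
  have htame : ∀ v ∈ A, (nbr G A v).card ≤ 7 → TameAt G A v := fun v hv h7 =>
    tameAt_of_card_le_seven hv (hne v hv) h7 (htri v hv) hno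
  obtain ⟨u, hu, hu7⟩ : ∃ u ∈ A, (nbr G A u).card ≤ 7 := by
    by_contra! h
    have := card_nsmul_le_sum A (fun v => (nbr G A v).card) 8 (fun v hv => h v hv)
    rw [← card_adjPairs, smul_eq_mul] at this
    omega
  have ht := htame u hu hu7
  by_cases hR : A ⊆ insert u (nbr G A u)
  · obtain ⟨w, hwA, -, -, hwne, hw5⟩ := ht.exists_card_nbr_le_five hu (empty_subset _) (by simp)
      (fun w _ _ => (filter_subset _ _).trans hR)
    have := (htame w hwA (by omega)).six_le
    omega
  · obtain ⟨x, hxA, hx⟩ := not_subset.1 hR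
    rw [mem_insert, not_or] at hx
    obtain ⟨C, S, hxC, hCA, huC, hCN, hC, hSN, hScl, hS3, hsep⟩ :=
      ht.exists_separation hxA hx.1 hx.2
    have hCS : Disjoint C S := disjoint_of_subset_right hSN hCN
    have hSA : S ⊆ A := hSN.trans (filter_subset _ _)
    have huS : u ∉ S := fun h => (mem_nbr.1 (hSN h)).2.ne rfl
    have hc1 : (C ∪ S).card = C.card + S.card := card_union_of_disjoint hCS
    have hc2 : (A \ C).card + C.card = A.card := card_sdiff_add_card_eq_card hCA
    have hlt1 : (C ∪ S).card < A.card := card_lt_card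
      ⟨union_subset hCA hSA, fun h => by
        rcases mem_union.1 (h hu) with h | h
        · exact huC h
        · exact huS h⟩
    have hCpos : 0 < C.card := card_pos.2 ⟨x, hxC⟩
    have hdx : 4 ≤ (nbr G A x).card := by
      obtain ⟨y, hy⟩ := hne x hxA
      exact (htri x hxA y hy).trans (card_le_card (filter_subset _ _))
    have h1 := ih G (C ∪ S) hlt1 (hdx.trans (card_le_card (hsep x hxC)))
      (fun h => hno (h.mono le_rfl (by exact_mod_cast union_subset hCA hSA)))
    have hN2 : nbr G A u ⊆ A \ C := fun v hv =>
      mem_sdiff.2 ⟨(mem_nbr.1 hv).1, fun h => Finset.disjoint_left.1 hCN h hv⟩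
    have h2 := ih G (A \ C) (by omega) (le_trans (by have := ht.six_le; omega) (card_le_card hN2))
      (fun h => hno (h.mono le_rfl (by exact_mod_cast sdiff_subset)))
    have hunion : adjPairs G A ⊆ adjPairs G (C ∪ S) ∪ adjPairs G (A \ C) := by
      rintro ⟨a, b⟩ hp
      obtain ⟨⟨ha, hb⟩, hab⟩ := mem_adjPairs.1 hp
      simp only at ha hb hab
      simp only [mem_union, mem_adjPairs, mem_sdiff]
      by_cases haC : a ∈ C
      · exact Or.inl ⟨⟨Or.inl haC, mem_union.1 (hsep a haC (mem_nbr.2 ⟨hb, hab⟩))⟩, hab⟩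
      by_cases hbC : b ∈ C
      · exact Or.inl ⟨⟨mem_union.1 (hsep b hbC (mem_nbr.2 ⟨ha, hab.symm⟩)), Or.inl hbC⟩, hab⟩
      exact Or.inr ⟨⟨⟨ha, haC⟩, hb, hbC⟩, hab⟩
    have hinter : S.offDiag ⊆ adjPairs G (C ∪ S) ∩ adjPairs G (A \ C) := by
      rintro ⟨a, b⟩ hp
      obtain ⟨ha, hb, hab⟩ := mem_offDiag.1 hp
      have hnC : ∀ s ∈ S, s ∉ C := fun s hs h => Finset.disjoint_left.1 hCS h hs
      have := hScl ha hb hab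
      simp only [mem_inter, mem_union, mem_adjPairs, mem_sdiff]
      exact ⟨⟨⟨Or.inr ha, Or.inr hb⟩, this⟩,
        ⟨⟨hSA ha, hnC a ha⟩, hSA hb, hnC b hb⟩, this⟩
    have hcu := card_le_card hunion
    have hci := card_le_card hinter
    have hcui := card_union_add_card_inter (adjPairs G (C ∪ S)) (adjPairs G (A \ C))
    rw [offDiag_card] at hci
    generalize S.card = s at *
    interval_cases s <;> omega

theorem card_adjPairs_add_le (n : ℕ) : ∀ (G : SimpleGraph V) (A : Finset V), A.card = n → 4 ≤ n →
    ¬ HasK6 G (A : Set V) → (adjPairs G A).card + 19 ≤ 8 * n := by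
  induction n using Nat.strong_induction_on with
  | _ n ihn =>
  have key : ∀ d, ∀ (G : SimpleGraph V) (A : Finset V), (adjPairs G A).card = d → A.card = n →
      4 ≤ n → ¬ HasK6 G (A : Set V) → d + 19 ≤ 8 * n := by
    intro d
    induction d using Nat.strong_induction_on with
    | _ d ihd =>
    rintro G A rfl hA h4 hno
    by_contra! hcon
    have hsub : adjPairs G A ⊆ A.offDiag := fun p hp => by
      obtain ⟨⟨h1, h2⟩, h3⟩ := mem_adjPairs.1 hp
      exact mem_offDiag.2 ⟨h1, h2, h3.ne⟩
    have hoff := card_le_card hsub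
    rw [offDiag_card, hA] at hoff
    have h5 : 5 ≤ n := by
      by_contra h
      obtain rfl : n = 4 := by omega
      omega
    subst hA
    by_cases hhi : (adjPairs G A).card < 8 * A.card
    · exact hno (hasK6_of_almost_extremal (fun H B hB hB4 => ihn _ hB H B rfl hB4) h5
        (by omega) hhi)
    obtain ⟨⟨x, y⟩, hp⟩ : (adjPairs G A).Nonempty := card_pos.1 (by omega)
    set H := G.deleteEdges {s(x, y)} with hH
    have hHle : H ≤ G := deleteEdges_le _
    have hsubH : adjPairs H A ⊆ adjPairs G A := fun p hp =>
      mem_adjPairs.2 ⟨(mem_adjPairs.1 hp).1, hHle (mem_adjPairs.1 hp).2⟩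
    have hlt : (adjPairs H A).card < (adjPairs G A).card := by
      refine card_lt_card ⟨hsubH, fun h => ?_⟩
      have := (mem_adjPairs.1 (h hp)).2
      simp [hH] at this
    have hle : adjPairs G A ⊆ adjPairs H A ∪ {(x, y), (y, x)} := by
      rintro ⟨a, b⟩ hab
      obtain ⟨h1, h2⟩ := mem_adjPairs.1 hab
      rw [mem_union, mem_adjPairs]
      by_cases h : s(a, b) = s(x, y)
      · right
        simpa using h
      · left
        exact ⟨h1, by simpa [hH, deleteEdges_adj] using ⟨h2, by simpa using h⟩⟩
    have hle' := (card_le_card hle).trans ((card_union_le _ _).trans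
      (Nat.add_le_add_left card_le_two _))
    have := ihd _ hlt H A rfl rfl h4 (fun h => hno (h.mono hHle le_rfl))
    omega
  exact fun G A hA => key _ G A rfl hA

/-- No graph without a `K₆` minor satisfies the triangle condition outside of a small clique. -/
theorem false_of_triangles_outside_clique {G : SimpleGraph V} (n : ℕ) : ∀ A S : Finset V,
    A.card = n → S ⊆ A → G.IsClique (S : Set V) → S.card ≤ 3 → ¬ HasK6 G (A : Set V) →
    (A \ S).Nonempty → (∀ u ∈ A, u ∉ S → (nbr G A u).Nonempty) →
    (∀ u ∈ A, u ∉ S → (nbr G A u).card ≤ 7 →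
      ∀ v ∈ nbr G A u, 4 ≤ (nbr G (nbr G A u) v).card) → False := by
  induction n using Nat.strong_induction_on with
  | _ n ih =>
  rintro A S rfl hSA hScl hS3 hno hAS hne htri
  have htame : ∀ u ∈ A, u ∉ S → (nbr G A u).card ≤ 7 → TameAt G A u := fun u hu huS h7 =>
    tameAt_of_card_le_seven hu (hne u hu huS) h7 (htri u hu huS h7) hno
  by_cases h8 : ∀ u ∈ A, u ∉ S → 8 ≤ (nbr G A u).card
  · obtain ⟨z, hz⟩ := hAS
    rw [mem_sdiff] at hz
    have hA8 := (h8 z hz.1 hz.2).trans (card_le_card (filter_subset _ _))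
    have h1 := card_nsmul_le_sum (A \ S) (fun v => (nbr G A v).card) 8
      (fun v hv => h8 v (mem_sdiff.1 hv).1 (mem_sdiff.1 hv).2)
    have h2 := card_nsmul_le_sum S (fun v => (nbr G A v).card) (S.card - 1) (fun v hv => by
      rw [← card_erase_of_mem hv]
      refine card_le_card fun w hw => ?_
      obtain ⟨hwv, hw⟩ := mem_erase.1 hw
      exact mem_nbr.2 ⟨hSA hw, hScl hv hw hwv.symm⟩)
    have h3 := sum_sdiff (f := fun v => (nbr G A v).card) hSA
    rw [← card_adjPairs] at h3
    have h4 := card_adjPairs_add_le _ G A rfl (by omega) hno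
    have h5 := card_sdiff_add_card_eq_card hSA
    simp only [smul_eq_mul] at h1 h2
    generalize S.card = s at *
    interval_cases s <;> omega
  push Not at h8
  obtain ⟨u, hu, huS, hu8⟩ := h8
  have ht := htame u hu huS (by omega)
  have hcomp : ∀ x ∈ A, x ≠ u → x ∉ nbr G A u → ∃ C : Finset V, x ∈ C ∧ C ⊆ A ∧ u ∉ C ∧
      (∀ c ∈ C, c ∉ nbr G A u) ∧ ConnectedOn G (C : Set V) ∧
      (∀ c ∈ C, ∀ y ∈ A, y ∉ nbr G A u → G.Adj c y → y ∈ C) ∧ ∃ s ∈ C, s ∈ S := by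
    intro x hx hxu hxN
    obtain ⟨C, T, hxC, hCA, huC, hCN, hC, hTN, hTcl, hT3, hsep⟩ := ht.exists_separation hx hxu hxN
    refine ⟨C, hxC, hCA, huC, fun c hc => Finset.disjoint_left.1 hCN hc, hC, ?_, ?_⟩
    · intro c hc y hy hyN hcy
      exact (mem_union.1 (hsep c hc (mem_nbr.2 ⟨hy, hcy⟩))).resolve_right fun h => hyN (hTN h)
    by_contra! hCS
    have hTA : T ⊆ A := hTN.trans (filter_subset _ _)
    have huT : u ∉ T := fun h => (mem_nbr.1 (hTN h)).2.ne rfl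
    have hsub : C ∪ T ⊆ A := union_subset hCA hTA
    have hlt : (C ∪ T).card < A.card := card_lt_card ⟨hsub, fun h => by
      rcases mem_union.1 (h hu) with h | h
      · exact huC h
      · exact huT h⟩
    have hmem : ∀ v ∈ C ∪ T, v ∉ T → v ∈ C ∧ nbr G (C ∪ T) v = nbr G A v := by
      intro v hv hvT
      have hvC := (mem_union.1 hv).resolve_right hvT
      refine ⟨hvC, subset_antisymm (filter_subset_filter _ hsub) fun w hw => ?_⟩
      exact mem_nbr.2 ⟨hsep v hvC hw, (mem_nbr.1 hw).2⟩
    refine ih _ hlt (C ∪ T) T rfl subset_union_right hTcl hT3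
      (fun h => hno (h.mono le_rfl (by exact_mod_cast hsub)))
      ⟨x, mem_sdiff.2 ⟨mem_union_left _ hxC, fun h => hxN (hTN h)⟩⟩ ?_ ?_
    · intro v hv hvT
      obtain ⟨hvC, h⟩ := hmem v hv hvT
      rw [h]
      exact hne v (hCA hvC) (hCS v hvC)
    · intro v hv hvT
      obtain ⟨hvC, h⟩ := hmem v hv hvT
      rw [h]
      exact htri v (hCA hvC) (hCS v hvC)
  set T := (nbr G A u).filter fun a =>
    a ∈ S ∨ ∃ r ∈ A, r ≠ u ∧ r ∉ nbr G A u ∧ G.Adj r a with hT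
  have hmixed : ∀ a ∈ nbr G A u, a ∈ S → ∀ b ∈ nbr G A u, a ≠ b →
      (∃ r ∈ A, r ≠ u ∧ r ∉ nbr G A u ∧ G.Adj r b) → G.Adj a b := by
    rintro a ha haS b hb hab ⟨r, hrA, hru, hrN, hrb⟩
    obtain ⟨C, hrC, hCA, huC, hCN, hC, -, s, hsC, hsS⟩ := hcomp r hrA hru hrN
    have hsa : s ≠ a := fun h => hCN s hsC (h ▸ ha)
    exact ht.adj_of_connectedOn C (by exact_mod_cast hCA) hC huC hCN a ha b hb hab
      ⟨s, hsC, hScl hsS haS hsa⟩ ⟨r, hrC, hrb⟩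
  have hTcl : G.IsClique (T : Set V) := by
    intro a ha b hb hab
    obtain ⟨ha, ha'⟩ := mem_filter.1 ha
    obtain ⟨hb, hb'⟩ := mem_filter.1 hb
    rcases ha' with haS | ha' <;> rcases hb' with hbS | hb'
    · exact hScl haS hbS hab
    · exact hmixed a ha haS b hb hab hb'
    · exact (hmixed b hb hbS a ha hab.symm ha').symm
    obtain ⟨r, hrA, hru, hrN, hra⟩ := ha'
    obtain ⟨q, hqA, hqu, hqN, hqb⟩ := hb'
    obtain ⟨C, hrC, hCA, huC, hCN, hC, hCcl, s, hsC, hsS⟩ := hcomp r hrA hru hrN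
    obtain ⟨D, hqD, hDA, huD, hDN, hD, -, t, htD, htS⟩ := hcomp q hqA hqu hqN
    have htC : t ∈ C := by
      by_cases hst : s = t
      · exact hst ▸ hsC
      · exact hCcl s hsC t (hDA htD) (hDN t htD) (hScl hsS htS hst)
    have hDC : (D : Set V) ⊆ C := hD.subset_of_closed htD htC
      fun p hp w hw hpw => hCcl p hp w (hDA hw) (hDN w hw) hpw
    exact ht.adj_of_connectedOn C (by exact_mod_cast hCA) hC huC hCN a ha b hb hab
      ⟨r, hrC, hra⟩ ⟨q, hDC hqD, hqb⟩
  obtain ⟨w, hwA, hwT, hwN, -, hw5⟩ := ht.exists_card_nbr_le_five hu (filter_subset _ _)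
    (ht.card_le_three T (filter_subset _ _) hTcl) (fun w hw hwT y hy => by
      by_contra hy'
      rw [mem_insert, not_or] at hy'
      obtain ⟨hyA, hwy⟩ := mem_nbr.1 hy
      exact hwT (mem_filter.2 ⟨hw, Or.inr ⟨y, hyA, hy'.1, hy'.2, hwy.symm⟩⟩))
  have hwS : w ∉ S := fun h => hwT (mem_filter.2 ⟨hwN, Or.inl h⟩)
  have := (htame w hwA hwS (by omega)).six_le
  omega

theorem top_minorOf_of_triangles [Fintype V] (G : SimpleGraph V) [DecidableRel G.Adj]
    (hedge : G.edgeSet.Nonempty)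
    (htri : ∀ u v : V, G.Adj u v → G.degree u ≤ 7 →
      4 ≤ (G.neighborSet u ∩ G.neighborSet v).ncard) :
    (⊤ : SimpleGraph (Fin 6)).MinorOf G := by
  by_contra hfree
  obtain ⟨e, he⟩ := hedge
  induction e using Sym2.ind with
  | _ x y =>
  rw [mem_edgeSet] at he
  set A : Finset V := univ.filter (fun v => ∃ w, G.Adj v w) with hA
  have hnbr : ∀ u, nbr G A u = G.neighborFinset u := by
    intro u
    ext v
    simp only [mem_nbr, hA, mem_filter, mem_univ, true_and, mem_neighborFinset]
    exact ⟨fun h => h.2, fun h => ⟨⟨u, h.symm⟩, h⟩⟩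
  refine false_of_triangles_outside_clique (G := G) A.card A ∅ rfl (empty_subset _) (by simp)
    (by simp) (fun h => hfree h.minorOf) ⟨x, by simpa [hA] using ⟨y, he⟩⟩ ?_ ?_
  · intro u hu _
    obtain ⟨w, hw⟩ := (mem_filter.1 hu).2
    exact ⟨w, by simpa [hnbr] using hw⟩
  · intro u _ _ h7 v hv
    rw [hnbr, card_neighborFinset_eq_degree] at h7
    have := htri u v (mem_nbr.1 hv).2 h7
    rw [← Set.ncard_coe_finset]
    convert this using 2
    ext w
    simp [mem_nbr, hnbr]

end

/-- Let `G` be a finite simple graph with at least one edge, no `K_6`-minor,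
such that every edge incident to a vertex of degree at most 7 belongs to at
least 4 triangles.  Then `δ(G) ≥ 6`, and for every vertex `u` of degree at most
7 the induced subgraph `G[N(u)]` has minimum degree at least 4 (i.e. every
`v ∈ N(u)` has at least 4 neighbors inside `N(u)`). -/
theorem statement13 {V : Type} [Fintype V] (G : SimpleGraph V) [DecidableRel G.Adj]
    (hedge : G.edgeSet.Nonempty)
    (hfree : ¬ (⊤ : SimpleGraph (Fin 6)).MinorOf G)
    (htri : ∀ u v : V, G.Adj u v → G.degree u ≤ 7 →
      4 ≤ (G.neighborSet u ∩ G.neighborSet v).ncard) :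
    6 ≤ G.minDegree ∧
      ∀ u : V, G.degree u ≤ 7 → ∀ v ∈ G.neighborSet u,
        4 ≤ (G.neighborSet u ∩ G.neighborSet v).ncard :=
  absurd (top_minorOf_of_triangles G hedge htri) hfree
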